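/- Fix m, ℓ, n ≥ 1 and variables x = (x_1,…,x_n), y = (y_1,…,y_n), t = (t_1,…,t_{ℓ−1}). Then the following Cauchy identity holds: s_{m^ℓ}(x_1,…,x_n, t_1,…,t_{ℓ−1}, y_1,…,y_n) = Σ_{λ ⊆ m^ℓ} g_λ(x;t) · g_{λ†}(y;t†), where the sum is over all partitions λ contained in the ℓ×m rectangle (i.e. λ_1 ≤ m and at most ℓ parts), λ† is the complement partition defined by λ†_i = m − λ_{ℓ+1−i} for 1 ≤ i ≤ ℓ, and t† = (t_{ℓ−1}, t_{ℓ−2}, …, t_1). -/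

import Mathlib

open scoped Classical

noncomputable section

variable {R : Type*} [CommRing R]

/-- The boxes of the Young diagram with row lengths `lam 0, …, lam (ℓ-1)`
(a box in row `r < ℓ` and column `c < lam r`, both 0-indexed). -/
abbrev YBox (ℓ : ℕ) (lam : ℕ → ℕ) : Type := Σ r : Fin ℓ, Fin (lam r.1)

/-- A reverse plane partition of skew shape `lam/mu` with entries in `{1, …, n}`,
encoded as a filling of the boxes of `lam` by values in `Fin (n+1)`, where the
value `0` is used exactly on the boxes of `mu`; rows weakly increase and
columns weakly increase. -/
def IsSkewRPP (ℓ n : ℕ) (lam mu : ℕ → ℕ) (T : YBox ℓ lam → Fin (n + 1)) : Prop :=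
  (∀ b : YBox ℓ lam, ((T b : ℕ) = 0 ↔ (b.2 : ℕ) < mu b.1.1)) ∧
  (∀ (r : Fin ℓ) (c c' : Fin (lam r.1)), mu r.1 ≤ (c : ℕ) → (c : ℕ) ≤ (c' : ℕ) →
    T ⟨r, c⟩ ≤ T ⟨r, c'⟩) ∧
  (∀ (r r' : Fin ℓ) (c : Fin (lam r.1)) (c' : Fin (lam r'.1)),
    (r : ℕ) ≤ (r' : ℕ) → (c : ℕ) = (c' : ℕ) → mu r.1 ≤ (c : ℕ) → mu r'.1 ≤ (c' : ℕ) →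
    T ⟨r, c⟩ ≤ T ⟨r', c'⟩)

/-- The weight of a box `b` of the skew shape `lam/mu` in a reverse plane
partition `T`: it is `t (r+1)` (`r+1` being the 1-indexed row of `b`) if the box
directly below `b` exists (in `lam`) and carries the same entry, and `x e`
otherwise, where `e ∈ {1, …, n}` is the entry of `b`.  Boxes of `mu` have
weight `1`. -/
def boxWeight (ℓ n : ℕ) (lam mu : ℕ → ℕ) (x t : ℕ → R)
    (T : YBox ℓ lam → Fin (n + 1)) (b : YBox ℓ lam) : R :=
  if mu b.1.1 ≤ (b.2 : ℕ) then
    if ∃ (hr : (b.1 : ℕ) + 1 < ℓ) (hc : (b.2 : ℕ) < lam ((b.1 : ℕ) + 1)),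
        T ⟨⟨(b.1 : ℕ) + 1, hr⟩, ⟨(b.2 : ℕ), hc⟩⟩ = T b
      then t ((b.1 : ℕ) + 1)
      else x (T b : ℕ)
  else 1

/-- The (skew) refined dual Grothendieck polynomial `g_{lam/mu}(x; t)`:
the sum of `∏_r t_r^{b_r(T)} ∏_i x_i^{a_i(T)}` over all reverse plane
partitions `T` of shape `lam/mu` with entries in `{1, …, n}`, where `b_r(T)`
is the number of boxes in row `r` whose entry equals that of the box directly
below it, and `a_i(T)` is the number of columns containing the entry `i`. -/
def dualGroth (ℓ n : ℕ) (lam mu : ℕ → ℕ) (x t : ℕ → R) : R :=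
  ∑ T ∈ Finset.univ.filter (IsSkewRPP ℓ n lam mu),
    ∏ b : YBox ℓ lam, boxWeight ℓ n lam mu x t T b

/-- Complete homogeneous symmetric function `h_k` of the entries of a list. -/
def hL (k : ℕ) (L : List R) : R :=
  ∑ f ∈ Finset.univ.filter (fun f : Fin k → Fin L.length => Monotone f),
    ∏ i, L.get (f i)

/-- Elementary symmetric function `e_k` of the entries of a list. -/
def eL (k : ℕ) (L : List R) : R :=
  ∑ f ∈ Finset.univ.filter (fun f : Fin k → Fin L.length => StrictMono f),
    ∏ i, L.get (f i)

/-- `h_d` for an integer degree `d`, with `h_d = 0` for `d < 0`. -/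
def hInt (d : ℤ) (L : List R) : R := if 0 ≤ d then hL d.toNat L else 0

/-- `e_d` for an integer degree `d`, with `e_d = 0` for `d < 0`. -/
def eInt (d : ℤ) (L : List R) : R := if 0 ≤ d then eL d.toNat L else 0

/-- Extend a function on `Fin ℓ` to `ℕ` by `0`. -/
def extendFin (ℓ : ℕ) (p : Fin ℓ → ℕ) : ℕ → ℕ :=
  fun r => if h : r < ℓ then p ⟨r, h⟩ else 0

/-- A semistandard Young tableau of shape `lam` with entries in `{1, …, N}`
(encoded with values in `Fin (N+1)`, the value `0` being unused): rows weakly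
increase and columns strictly increase. -/
def IsSSYT (ℓ N : ℕ) (lam : ℕ → ℕ) (T : YBox ℓ lam → Fin (N + 1)) : Prop :=
  (∀ b : YBox ℓ lam, 1 ≤ (T b : ℕ)) ∧
  (∀ (r : Fin ℓ) (c c' : Fin (lam r.1)), (c : ℕ) ≤ (c' : ℕ) → T ⟨r, c⟩ ≤ T ⟨r, c'⟩) ∧
  (∀ (r r' : Fin ℓ) (c : Fin (lam r.1)) (c' : Fin (lam r'.1)),
    (r : ℕ) < (r' : ℕ) → (c : ℕ) = (c' : ℕ) → T ⟨r, c⟩ < T ⟨r', c'⟩)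

/-- The Schur polynomial `s_lam (z 1, …, z N)`: the sum of `z^T` over all
semistandard Young tableaux of shape `lam` with entries in `{1, …, N}`. -/
def schurPoly (ℓ N : ℕ) (lam : ℕ → ℕ) (z : ℕ → R) : R :=
  ∑ T ∈ Finset.univ.filter (IsSSYT ℓ N lam),
    ∏ b : YBox ℓ lam, z (T b : ℕ)

/-- Partitions contained in the `ℓ × m` rectangle. -/
abbrev BoxPartition (ℓ m : ℕ) : Type :=
  {p : Fin ℓ → Fin (m + 1) // ∀ i j : Fin ℓ, i ≤ j → p j ≤ p i}

namespace BoxPartition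

variable {ℓ m : ℕ}

/-- The row lengths of a partition, extended by `0`. -/
def row (p : BoxPartition ℓ m) : ℕ → ℕ := extendFin ℓ fun a => (p.1 a : ℕ)

theorem row_of_lt (p : BoxPartition ℓ m) {r : ℕ} (h : r < ℓ) : p.row r = p.1 ⟨r, h⟩ := by
  simp [row, extendFin, h]

theorem row_eq_zero (p : BoxPartition ℓ m) {r : ℕ} (h : ℓ ≤ r) : p.row r = 0 := by
  simp [row, extendFin, Nat.not_lt.mpr h]

theorem row_le (p : BoxPartition ℓ m) (r : ℕ) : p.row r ≤ m := by
  by_cases h : r < ℓ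
  · rw [p.row_of_lt h]; omega
  · rw [p.row_eq_zero (not_lt.mp h)]; omega

theorem row_antitone (p : BoxPartition ℓ m) : Antitone p.row := by
  intro r s h
  by_cases hs : s < ℓ
  · rw [p.row_of_lt hs, p.row_of_lt (h.trans_lt hs)]
    exact p.2 _ _ h
  · rw [p.row_eq_zero (not_lt.mp hs)]; omega

theorem row_succ_le (p : BoxPartition ℓ m) (r : ℕ) : p.row (r + 1) ≤ p.row r :=
  p.row_antitone r.le_succ

theorem ext_row {p q : BoxPartition ℓ m} (h : ∀ r < ℓ, p.row r = q.row r) : p = q := by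
  apply Subtype.ext
  funext i
  have := h i i.2
  rw [p.row_of_lt i.2, q.row_of_lt i.2] at this
  exact Fin.ext this

/-- The empty partition. -/
def empty : BoxPartition ℓ m := ⟨fun _ => 0, fun _ _ _ => le_rfl⟩

/-- The rectangle `m^ℓ`. -/
def full : BoxPartition ℓ m := ⟨fun _ => Fin.last m, fun _ _ _ => le_rfl⟩

@[simp] theorem row_empty (r : ℕ) : (empty : BoxPartition ℓ m).row r = 0 := by
  simp [row, extendFin, empty]

theorem row_full {r : ℕ} (h : r < ℓ) : (full : BoxPartition ℓ m).row r = m := by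
  simp [row, extendFin, full, h]

/-- The partition with given row lengths, or the empty partition if these do not form a
partition contained in the rectangle. -/
def ofRows (f : ℕ → ℕ) : BoxPartition ℓ m :=
  if h : (∀ r < ℓ, f r ≤ m) ∧ ∀ r s, r ≤ s → s < ℓ → f s ≤ f r then
    ⟨fun i => ⟨f i, Nat.lt_succ_of_le (h.1 i i.2)⟩, fun i j hij => h.2 i j hij j.2⟩
  else empty

theorem row_ofRows {f : ℕ → ℕ} (hm : ∀ r < ℓ, f r ≤ m)
    (ha : ∀ r s, r ≤ s → s < ℓ → f s ≤ f r) {r : ℕ} (hr : r < ℓ) :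
    (ofRows f : BoxPartition ℓ m).row r = f r := by
  rw [row_of_lt _ hr, ofRows, dif_pos ⟨hm, ha⟩]

/-- The complement of a partition in the rectangle. -/
def compl (p : BoxPartition ℓ m) : BoxPartition ℓ m :=
  ⟨fun i => (p.1 i.rev).rev, fun _ _ h =>
    Fin.rev_le_rev.mpr (p.2 _ _ (Fin.rev_le_rev.mpr h))⟩

theorem compl_compl (p : BoxPartition ℓ m) : p.compl.compl = p := by
  apply Subtype.ext
  funext i
  simp [compl]

theorem row_compl (p : BoxPartition ℓ m) {r : ℕ} (h : r < ℓ) :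
    p.compl.row r = m - p.row (ℓ - 1 - r) := by
  have h' : ℓ - 1 - r < ℓ := by omega
  rw [row_of_lt _ h, row_of_lt _ h']
  have : (⟨r, h⟩ : Fin ℓ).rev = ⟨ℓ - 1 - r, h'⟩ := Fin.ext (by simp; omega)
  simp only [compl, this, Fin.val_rev]
  omega

theorem compl_empty : (empty : BoxPartition ℓ m).compl = full := by
  apply Subtype.ext
  funext i
  exact Fin.ext (by simp [compl, empty, full])

/-- Complementation as an involutive equivalence. -/
def complEquiv : BoxPartition ℓ m ≃ BoxPartition ℓ m :=
  ⟨compl, compl, compl_compl, compl_compl⟩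

end BoxPartition

open BoxPartition

/-- The single-variable skew refined dual Grothendieck polynomials `g_{q/p}(x; t)`, as a matrix
indexed by partitions in a rectangle. -/
def growthKernel {ℓ m : ℕ} (x : R) (t : ℕ → R) :
    Matrix (BoxPartition ℓ m) (BoxPartition ℓ m) R := fun p q =>
  if ∀ r, p.row r ≤ q.row r then
    ∏ r ∈ Finset.range ℓ, t (r + 1) ^ (q.row (r + 1) - p.row r) *
      x ^ (q.row r - max (p.row r) (q.row (r + 1)))
  else 0

/-- Adding a horizontal strip weighted by `s` to the rows of index at least `k`. -/
def stripKernel {ℓ m : ℕ} (k : ℕ) (s : R) :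
    Matrix (BoxPartition ℓ m) (BoxPartition ℓ m) R := fun p q =>
  if ∀ r < k, p.row r = q.row r then growthKernel s 0 p q else 0

variable {ℓ m : ℕ}

theorem growthKernel_apply_of_vanish (x : R) (t : ℕ → R) (k : ℕ) (ht : ∀ j, k < j → t j = 0)
    (p q : BoxPartition ℓ m) :
    growthKernel x t p q =
      if (∀ r, p.row r ≤ q.row r) ∧ ∀ r, k ≤ r → q.row (r + 1) ≤ p.row r then
        (∏ r ∈ Finset.range k, t (r + 1) ^ (q.row (r + 1) - p.row r)) *
          x ^ ∑ r ∈ Finset.range ℓ, (q.row r - max (p.row r) (q.row (r + 1)))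
      else 0 := by
  unfold growthKernel
  by_cases h : ∀ r, p.row r ≤ q.row r
  swap
  · rw [if_neg h, if_neg fun H => h H.1]
  rw [if_pos h, Finset.prod_mul_distrib, Finset.prod_pow_eq_pow_sum]
  by_cases h2 : ∀ r, k ≤ r → q.row (r + 1) ≤ p.row r
  · rw [if_pos ⟨h, h2⟩]
    congr 1
    trans ∏ r ∈ Finset.range (max k ℓ), t (r + 1) ^ (q.row (r + 1) - p.row r)
    · apply Finset.prod_subset
      · intro r; simp only [Finset.mem_range]; omega
      · intro r _ hr
        rw [q.row_eq_zero (by simp only [Finset.mem_range] at hr; omega), Nat.zero_sub, pow_zero]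
    · symm
      apply Finset.prod_subset
      · intro r; simp only [Finset.mem_range]; omega
      · intro r _ hr
        rw [Nat.sub_eq_zero_of_le (h2 r (by simpa using hr)), pow_zero]
  · rw [if_neg fun H => h2 H.2]
    push Not at h2
    obtain ⟨r, hk, hr⟩ := h2
    have hl : r < ℓ := by
      by_contra hc
      rw [q.row_eq_zero (by omega)] at hr
      omega
    rw [Finset.prod_eq_zero (Finset.mem_range.mpr hl), zero_mul]
    rw [ht _ (by omega), zero_pow (by omega)]

theorem stripKernel_apply (k : ℕ) (s : R) (p q : BoxPartition ℓ m) :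
    stripKernel k s p q =
      if (∀ r < k, p.row r = q.row r) ∧ (∀ r, p.row r ≤ q.row r) ∧
          ∀ r, q.row (r + 1) ≤ p.row r then
        s ^ ∑ r ∈ Finset.range ℓ, (q.row r - p.row r)
      else 0 := by
  unfold stripKernel
  rw [growthKernel_apply_of_vanish s 0 0 (fun _ _ => rfl), ← ite_and]
  simp only [Finset.range_zero, Finset.prod_empty, one_mul, zero_le, true_implies]
  split_ifs with h
  · congr 1
    exact Finset.sum_congr rfl fun r _ => by rw [max_eq_left (h.2.2 r)]
  · rfl

/-- The reflection of row `r` of an intermediate partition between `p` and `q` inside the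
interval of its admissible values. -/
def reflectRow (p q u : ℕ → ℕ) (r : ℕ) : ℕ :=
  max (p r) (q (r + 1)) + min (q r) (if r = 0 then q 0 else p (r - 1)) - u r

/-- The reflected partition, agreeing with `e` in the rows of index less than `k`. -/
def reflect (k : ℕ) (e p q u : BoxPartition ℓ m) : BoxPartition ℓ m :=
  ofRows fun r => if r < k then e.row r else reflectRow p.row q.row u.row r

/-- The rows of index at least `k` of `u` interlace with those of `p` and `q`. -/
def Interlaces (k : ℕ) (p q u : BoxPartition ℓ m) : Prop :=
  ∀ r, k ≤ r → p.row r ≤ u.row r ∧ q.row (r + 1) ≤ u.row r ∧ u.row r ≤ q.row r ∧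
    (1 ≤ r → u.row r ≤ p.row (r - 1))

theorem Interlaces.reflectRow_mem {k : ℕ} {p q u : BoxPartition ℓ m} (hu : Interlaces k p q u)
    {r : ℕ} (hr : k ≤ r) :
    p.row r ≤ reflectRow p.row q.row u.row r ∧ q.row (r + 1) ≤ reflectRow p.row q.row u.row r ∧
      reflectRow p.row q.row u.row r ≤ q.row r ∧
      (1 ≤ r → reflectRow p.row q.row u.row r ≤ p.row (r - 1)) := by
  obtain ⟨h1, h2, h3, h4⟩ := hu r hr
  unfold reflectRow
  split_ifs with h0
  · subst h0
    omega
  · have := h4 (by omega)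
    omega

theorem row_reflect {k : ℕ} {e p q u : BoxPartition ℓ m} (hu : Interlaces k p q u)
    (he : ∀ r, p.row r ≤ e.row r) (r : ℕ) :
    (reflect k e p q u).row r =
      if r < k then e.row r else reflectRow p.row q.row u.row r := by
  set f : ℕ → ℕ := fun r => if r < k then e.row r else reflectRow p.row q.row u.row r with hf
  have hanti : Antitone f := by
    refine antitone_nat_of_succ_le fun r => ?_
    simp only [hf]
    split_ifs with h1 h2 h2
    · exact e.row_succ_le r
    · omega
    · have := (hu.reflectRow_mem (not_lt.mp h1)).2.2.2 (by omega)
      exact this.trans (he r)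
    · have h3 := (hu.reflectRow_mem (not_lt.mp h1)).2.2.2 (by omega)
      have h4 := (hu.reflectRow_mem (not_lt.mp h2)).1
      exact h3.trans h4
  have hle : ∀ r, f r ≤ m := fun r => by
    simp only [hf]
    split_ifs with h
    · exact e.row_le r
    · exact ((hu.reflectRow_mem (not_lt.mp h)).2.2.1).trans (q.row_le r)
  by_cases hr : r < ℓ
  · exact row_ofRows (fun r _ => hle r) (fun r s hrs _ => hanti hrs) hr
  · rw [row_eq_zero _ (not_lt.mp hr)]
    split_ifs with h
    · rw [e.row_eq_zero (not_lt.mp hr)]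
    · have := (hu.reflectRow_mem (not_lt.mp h)).2.2.1
      rw [q.row_eq_zero (not_lt.mp hr)] at this
      omega

theorem Interlaces.reflect {k : ℕ} {e p q u : BoxPartition ℓ m} (hu : Interlaces k p q u)
    (he : ∀ r, p.row r ≤ e.row r) : Interlaces k p q (reflect k e p q u) := by
  intro r hr
  rw [row_reflect hu he, if_neg (not_lt.mpr hr)]
  exact hu.reflectRow_mem hr

theorem reflect_reflect {k : ℕ} {e e' p q u : BoxPartition ℓ m} (hu : Interlaces k p q u)
    (he : ∀ r, p.row r ≤ e.row r) (he' : ∀ r, p.row r ≤ e'.row r)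
    (hk : ∀ r < k, u.row r = e'.row r) :
    reflect k e' p q (reflect k e p q u) = u := by
  refine ext_row fun r _ => ?_
  rw [row_reflect (hu.reflect he) he']
  split_ifs with h
  · exact (hk r h).symm
  · obtain ⟨h1, h2, h3, h4⟩ := hu r (not_lt.mp h)
    unfold reflectRow
    rw [row_reflect hu he, if_neg h]
    unfold reflectRow
    split_ifs with h0
    · subst h0
      omega
    · have := h4 (by omega)
      omega

/-- Summation of a telescoping identity between two sequences of natural numbers. -/
theorem sum_range_add_of_telescope (a b d : ℕ → ℕ) (h : ∀ r, a r + d (r + 1) = b r + d r)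
    (N : ℕ) : ∑ r ∈ Finset.range N, a r + d N = ∑ r ∈ Finset.range N, b r + d 0 := by
  induction N with
  | zero => simp
  | succ N ih =>
    rw [Finset.sum_range_succ, Finset.sum_range_succ]
    have := h N
    omega

/-- How far row `r` of `q` overhangs row `r - 1` of `p`. -/
def overhang (p q : ℕ → ℕ) (r : ℕ) : ℕ := if r = 0 then 0 else q r - p (r - 1)

theorem add_reflectRow {k : ℕ} {p q u : BoxPartition ℓ m} (hu : Interlaces k p q u) {r : ℕ}
    (hr : k ≤ r) :
    u.row r + reflectRow p.row q.row u.row r + overhang p.row q.row r =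
      p.row r + q.row r + overhang p.row q.row (r + 1) := by
  obtain ⟨h1, h2, h3, h4⟩ := hu r hr
  unfold reflectRow overhang
  simp only [Nat.add_sub_cancel, if_neg (Nat.succ_ne_zero r)]
  split_ifs with h0
  · subst h0
    omega
  · have := h4 (by omega)
    omega

theorem stripKernel_mul_growthKernel (k : ℕ) (s x : R) (t t' : ℕ → R)
    (ht : ∀ j, k < j → t j = 0) (ht' : ∀ j, t' j = if j < k then t j else 0)
    (hs : 1 ≤ k → s = t k) :
    (stripKernel k s * growthKernel x t : Matrix (BoxPartition ℓ m) (BoxPartition ℓ m) R) =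
      growthKernel x t' * stripKernel k s := by
  ext p q
  rw [Matrix.mul_apply, Matrix.mul_apply]
  have ht1 : ∀ j, k - 1 < j → t' j = 0 := fun j hj => by
    rw [ht']
    split_ifs with h
    · omega
    · rfl
  simp only [stripKernel_apply, growthKernel_apply_of_vanish x t k ht,
    growthKernel_apply_of_vanish x t' (k - 1) ht1, ite_zero_mul_ite_zero]
  rw [← Finset.sum_filter, ← Finset.sum_filter]
  have hL : ∀ u : BoxPartition ℓ m,
      (((∀ r < k, p.row r = u.row r) ∧ (∀ r, p.row r ≤ u.row r) ∧
          ∀ r, u.row (r + 1) ≤ p.row r) ∧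
        (∀ r, u.row r ≤ q.row r) ∧ ∀ r, k ≤ r → q.row (r + 1) ≤ u.row r) ↔
      ((∀ r, p.row r ≤ q.row r) ∧ Interlaces k p q u ∧ ∀ r < k, u.row r = p.row r) := by
    intro u
    constructor
    · rintro ⟨⟨h1, h2, h3⟩, h4, h5⟩
      refine ⟨fun r => (h2 r).trans (h4 r), fun r hr => ⟨h2 r, h5 r hr, h4 r, fun h => ?_⟩,
        fun r hr => (h1 r hr).symm⟩
      have := h3 (r - 1)
      rwa [Nat.sub_add_cancel h] at this
    · rintro ⟨h1, h2, h3⟩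
      refine ⟨⟨fun r hr => (h3 r hr).symm, fun r => ?_, fun r => ?_⟩, fun r => ?_,
        fun r hr => (h2 r hr).2.1⟩
      · by_cases hr : r < k
        · exact (h3 r hr).ge
        · exact (h2 r (not_lt.mp hr)).1
      · by_cases hr : r + 1 < k
        · exact (h3 _ hr).le.trans (p.row_succ_le r)
        · exact (h2 _ (not_lt.mp hr)).2.2.2 (by omega)
      · by_cases hr : r < k
        · exact (h3 r hr).le.trans (h1 r)
        · exact (h2 r (not_lt.mp hr)).2.2.1
  have hR : ∀ u : BoxPartition ℓ m,
      (((∀ r, p.row r ≤ u.row r) ∧ ∀ r, k - 1 ≤ r → u.row (r + 1) ≤ p.row r) ∧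
        (∀ r < k, u.row r = q.row r) ∧ (∀ r, u.row r ≤ q.row r) ∧
          ∀ r, q.row (r + 1) ≤ u.row r) ↔
      ((∀ r, p.row r ≤ q.row r) ∧ Interlaces k p q u ∧ ∀ r < k, u.row r = q.row r) := by
    intro u
    constructor
    · rintro ⟨⟨h1, h2⟩, h3, h4, h5⟩
      refine ⟨fun r => (h1 r).trans (h4 r), fun r hr => ⟨h1 r, h5 r, h4 r, fun h => ?_⟩, h3⟩
      have := h2 (r - 1) (by omega)
      rwa [Nat.sub_add_cancel h] at this
    · rintro ⟨h1, h2, h3⟩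
      refine ⟨⟨fun r => ?_, fun r hr => (h2 (r + 1) (by omega)).2.2.2 (by omega)⟩, h3,
        fun r => ?_, fun r => ?_⟩
      · by_cases hr : r < k
        · exact (h1 r).trans (h3 r hr).ge
        · exact (h2 r (not_lt.mp hr)).1
      · by_cases hr : r < k
        · exact (h3 r hr).le
        · exact (h2 r (not_lt.mp hr)).2.2.1
      · by_cases hr : r < k
        · exact (q.row_succ_le r).trans (h3 r hr).ge
        · exact (h2 r (not_lt.mp hr)).2.1
  simp only [hL, hR]
  refine Finset.sum_nbij' (reflect k q p q) (reflect k p p q) ?_ ?_ ?_ ?_ ?_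
  · intro u hu
    obtain ⟨h1, h2, h3⟩ := (Finset.mem_filter.mp hu).2
    exact Finset.mem_filter.mpr ⟨Finset.mem_univ _, h1, h2.reflect h1,
      fun r hr => by rw [row_reflect h2 h1, if_pos hr]⟩
  · intro u hu
    obtain ⟨h1, h2, h3⟩ := (Finset.mem_filter.mp hu).2
    exact Finset.mem_filter.mpr ⟨Finset.mem_univ _, h1, h2.reflect fun _ => le_rfl,
      fun r hr => by rw [row_reflect h2 fun _ => le_rfl, if_pos hr]⟩
  · intro u hu
    obtain ⟨h1, h2, h3⟩ := (Finset.mem_filter.mp hu).2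
    exact reflect_reflect h2 h1 (fun _ => le_rfl) h3
  · intro u hu
    obtain ⟨h1, h2, h3⟩ := (Finset.mem_filter.mp hu).2
    exact reflect_reflect h2 (fun _ => le_rfl) h1 h3
  · intro u hu
    obtain ⟨h1, h2, h3⟩ := (Finset.mem_filter.mp hu).2
    set v := reflect k q p q u with hv
    have hvr : ∀ r, v.row r = if r < k then q.row r else reflectRow p.row q.row u.row r :=
      row_reflect h2 h1
    have hv2 : Interlaces k p q v := h2.reflect h1
    have hov : ∀ r, ℓ ≤ r → overhang p.row q.row r = 0 := by
      intro r hr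
      unfold overhang
      rw [q.row_eq_zero hr]
      simp
    have hadd : ∀ r, k ≤ r → u.row r + v.row r + overhang p.row q.row r =
        p.row r + q.row r + overhang p.row q.row (r + 1) := by
      intro r hr
      rw [hvr, if_neg (not_lt.mpr hr)]
      exact add_reflectRow h2 hr
    have hx : ∑ r ∈ Finset.range ℓ, (q.row r - max (u.row r) (q.row (r + 1))) =
        ∑ r ∈ Finset.range ℓ, (v.row r - max (p.row r) (v.row (r + 1))) := by
      have := sum_range_add_of_telescope
        (fun r => q.row r - max (u.row r) (q.row (r + 1)))
        (fun r => v.row r - max (p.row r) (v.row (r + 1)))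
        (fun r => if k ≤ r then overhang p.row q.row r else 0) (fun r => ?_) ℓ
      · have h0 : overhang p.row q.row 0 = 0 := by simp [overhang]
        simpa [h0, hov ℓ le_rfl] using this
      · rcases lt_trichotomy (r + 1) k with hr | hr | hr
        · have e1 := hvr r
          have e2 := hvr (r + 1)
          rw [if_pos (by omega)] at e1 e2
          simp only [if_neg (show ¬ k ≤ r + 1 by omega), if_neg (show ¬ k ≤ r by omega), e1, e2,
            h3 r (by omega)]
        · have e1 := hvr r
          rw [if_pos (by omega)] at e1
          have e2 := (hv2 (r + 1) hr.ge).2.2.2 (by omega)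
          have e3 := q.row_succ_le r
          have e4 := h1 r
          simp only [if_pos hr.ge, if_neg (show ¬ k ≤ r by omega), e1, h3 r (by omega), overhang,
            if_neg (Nat.succ_ne_zero r), Nat.add_sub_cancel] at e2 ⊢
          omega
        · have e1 := hadd r (by omega)
          have e2 := (hv2 (r + 1) (by omega)).2.2.2 (by omega)
          obtain ⟨e3, e4, e5, -⟩ := h2 r (by omega)
          obtain ⟨e6, -, e7, -⟩ := hv2 r (by omega)
          simp only [if_pos (show k ≤ r + 1 by omega), if_pos (show k ≤ r by omega),
            Nat.add_sub_cancel] at e2 ⊢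
          omega
    have hs' : ∑ r ∈ Finset.range ℓ, (q.row r - v.row r) =
        ∑ r ∈ Finset.range ℓ, (u.row r - p.row r) + overhang p.row q.row k := by
      have := sum_range_add_of_telescope (fun r => q.row r - v.row r)
        (fun r => u.row r - p.row r) (fun r => overhang p.row q.row (max r k)) (fun r => ?_) ℓ
      · simpa [hov (max ℓ k) (le_max_left _ _)] using this
      · by_cases hr : r < k
        · have e1 := hvr r
          rw [if_pos hr] at e1
          simp only [e1, h3 r hr, max_eq_right hr.le, max_eq_right (show r + 1 ≤ k by omega),
            Nat.sub_self]
        · have e1 := hadd r (by omega)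
          obtain ⟨e3, -, e5, -⟩ := h2 r (by omega)
          obtain ⟨e6, -, e7, -⟩ := hv2 r (by omega)
          simp only [max_eq_left (show k ≤ r by omega), max_eq_left (show k ≤ r + 1 by omega)]
          omega
    have hprod : (∏ r ∈ Finset.range k, t (r + 1) ^ (q.row (r + 1) - u.row r)) =
        (∏ r ∈ Finset.range (k - 1), t' (r + 1) ^ (v.row (r + 1) - p.row r)) *
          s ^ overhang p.row q.row k := by
      rcases k with _ | k
      · simp [overhang]
      · rw [Finset.prod_range_succ, hs (by omega), h3 k (by omega)]
        simp only [overhang, if_neg (Nat.succ_ne_zero k), Nat.add_sub_cancel]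
        congr 1
        refine Finset.prod_congr rfl fun r hr => ?_
        have hr' := Finset.mem_range.mp hr
        rw [ht', if_pos (by omega), hvr, if_pos (by omega), h3 r (by omega)]
    rw [hx, hs', hprod, pow_add]
    ring

theorem growthKernel_congr (x : R) {t t' : ℕ → R} (h : ∀ r, r + 1 < ℓ → t (r + 1) = t' (r + 1)) :
    (growthKernel x t : Matrix (BoxPartition ℓ m) (BoxPartition ℓ m) R) = growthKernel x t' := by
  ext p q
  unfold growthKernel
  congr 1
  refine Finset.prod_congr rfl fun r _ => ?_
  by_cases hr : r + 1 < ℓ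
  · rw [h r hr]
  · rw [q.row_eq_zero (not_lt.mp hr), Nat.zero_sub, pow_zero, pow_zero]

theorem stripKernel_zero (s : R) :
    (stripKernel 0 s : Matrix (BoxPartition ℓ m) (BoxPartition ℓ m) R) = growthKernel s 0 := by
  ext p q
  simp [stripKernel]

theorem growthKernel_zero_commute (x y : R) :
    Commute (growthKernel x 0 : Matrix (BoxPartition ℓ m) (BoxPartition ℓ m) R)
      (growthKernel y 0) := by
  have := stripKernel_mul_growthKernel (ℓ := ℓ) (m := m) 0 x y 0 0 (fun _ _ => rfl)
    (fun j => by simp) (by omega)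
  rwa [stripKernel_zero] at this

theorem growthKernel_compl (x : R) (t : ℕ → R) (p q : BoxPartition ℓ m) :
    growthKernel x (fun k => t (ℓ - k)) p q = growthKernel x t q.compl p.compl := by
  unfold growthKernel
  have hiff : (∀ r, p.row r ≤ q.row r) ↔ ∀ r, q.compl.row r ≤ p.compl.row r := by
    constructor
    · intro h r
      by_cases hr : r < ℓ
      · rw [row_compl _ hr, row_compl _ hr]
        have := h (ℓ - 1 - r)
        omega
      · rw [row_eq_zero _ (not_lt.mp hr)]
        omega
    · intro h r
      by_cases hr : r < ℓ
      · have := h (ℓ - 1 - r)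
        rw [row_compl _ (by omega), row_compl _ (by omega),
          show ℓ - 1 - (ℓ - 1 - r) = r by omega] at this
        have := p.row_le r
        have := q.row_le r
        omega
      · rw [row_eq_zero _ (not_lt.mp hr)]
        omega
  rcases ℓ with _ | L
  · simp [hiff]
  refine if_ctx_congr hiff (fun h' => ?_) fun _ => rfl
  have h := hiff.mpr h'
  rw [Finset.prod_mul_distrib, Finset.prod_mul_distrib, Finset.prod_pow_eq_pow_sum,
    Finset.prod_pow_eq_pow_sum]
  congr 1
  · rw [Finset.prod_range_succ, Finset.prod_range_succ, q.row_eq_zero le_rfl,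
      p.compl.row_eq_zero le_rfl, Nat.zero_sub, Nat.zero_sub, pow_zero, pow_zero, mul_one, mul_one,
      ← Finset.prod_range_reflect]
    refine Finset.prod_congr rfl fun r hr => ?_
    have hr' := Finset.mem_range.mp hr
    rw [row_compl _ (by omega), row_compl _ (by omega)]
    have e1 : L - 1 - r + 1 = L - r := by omega
    have e2 : L + 1 - (L - r) = r + 1 := by omega
    have e3 : L + 1 - 1 - (r + 1) = L - 1 - r := by omega
    have e4 : L + 1 - 1 - r = L - r := by omega
    simp only [e1, e2, e3, e4]
    have := p.row_le (L - 1 - r)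
    have := q.row_le (L - r)
    congr 1
    omega
  · congr 1
    rw [← Finset.sum_range_reflect (fun r => p.compl.row r - _)]
    have := sum_range_add_of_telescope
      (fun r => q.row r - max (p.row r) (q.row (r + 1)))
      (fun r => q.row r - p.row r - overhang p.row q.row r)
      (overhang p.row q.row) (fun r => ?_) (L + 1)
    · simp only [show overhang p.row q.row 0 = 0 by simp [overhang],
        show overhang p.row q.row (L + 1) = 0 by simp [overhang, q.row_eq_zero le_rfl],
        add_zero] at this
      refine this.trans ?_
      refine Finset.sum_congr rfl fun r hr => ?_
      have hr' := Finset.mem_range.mp hr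
      rw [row_compl _ (by omega), row_compl _ (by omega),
        show L + 1 - 1 - (L + 1 - 1 - r) = r by omega]
      have := p.row_le r
      have := q.row_le r
      have := h r
      unfold overhang
      split_ifs with h0
      · subst h0
        rw [p.compl.row_eq_zero (r := L + 1 - 1 - 0 + 1) (by omega)]
        omega
      · rw [row_compl _ (by omega),
          show L + 1 - 1 - (L + 1 - 1 - r + 1) = r - 1 by omega]
        have := p.row_le (r - 1)
        have := p.row_antitone (Nat.sub_le r 1)
        omega
    · have e1 := h r
      have e2 := q.row_succ_le r
      unfold overhang
      rw [if_neg (Nat.succ_ne_zero r), Nat.add_sub_cancel]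
      split_ifs with h0
      · omega
      · have := p.row_antitone (Nat.sub_le r 1)
        omega

/-- Multi-variable skew refined dual Grothendieck polynomials, as a matrix. -/
def growthProd (t : ℕ → R) (L : List R) : Matrix (BoxPartition ℓ m) (BoxPartition ℓ m) R :=
  (L.map fun x => growthKernel x t).prod

theorem growthProd_append (t : ℕ → R) (L L' : List R) :
    (growthProd t (L ++ L') : Matrix (BoxPartition ℓ m) (BoxPartition ℓ m) R) =
      growthProd t L * growthProd t L' := by
  simp [growthProd]

theorem growthProd_zero_perm {L L' : List R} (h : L.Perm L') :
    (growthProd 0 L : Matrix (BoxPartition ℓ m) (BoxPartition ℓ m) R) = growthProd 0 L' := by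
  refine (h.map _).prod_eq' ?_
  rw [List.pairwise_map]
  exact List.pairwise_of_forall fun x y => growthKernel_zero_commute x y

theorem growthProd_compl (t : ℕ → R) (L : List R) (p q : BoxPartition ℓ m) :
    growthProd (fun k => t (ℓ - k)) L p q = growthProd t L.reverse q.compl p.compl := by
  induction L generalizing p q with
  | nil =>
    simp only [growthProd, List.map_nil, List.prod_nil, List.reverse_nil, Matrix.one_apply]
    refine if_congr ⟨fun h => by rw [h], fun h => ?_⟩ rfl rfl
    rw [← p.compl_compl, ← q.compl_compl, h]
  | cons x L ih =>
    rw [List.reverse_cons, growthProd_append, ← List.singleton_append, growthProd_append,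
      Matrix.mul_apply, Matrix.mul_apply, ← Equiv.sum_comp complEquiv]
    refine Finset.sum_congr rfl fun u _ => ?_
    rw [ih, mul_comm]
    simp only [growthProd, List.map_singleton, List.prod_singleton, growthKernel_compl]
    simp only [complEquiv, Equiv.coe_fn_mk, BoxPartition.compl_compl]

/-- Successive horizontal strips, the `i`-th of which avoids the first `i` rows (`1 ≤ i ≤ k`). -/
def stripProd (t : ℕ → R) (k : ℕ) : Matrix (BoxPartition ℓ m) (BoxPartition ℓ m) R :=
  ((List.range k).map fun i => stripKernel (i + 1) (t (i + 1))).prod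

theorem stripProd_succ (t : ℕ → R) (k : ℕ) :
    (stripProd t (k + 1) : Matrix (BoxPartition ℓ m) (BoxPartition ℓ m) R) =
      stripProd t k * stripKernel (k + 1) (t (k + 1)) := by
  simp [stripProd, List.range_succ]

theorem stripProd_mul_growthKernel_truncate (t : ℕ → R) (x : R) (k : ℕ) :
    (stripProd t k * growthKernel x (fun j => if j < k + 1 then t j else 0) :
      Matrix (BoxPartition ℓ m) (BoxPartition ℓ m) R) = growthKernel x 0 * stripProd t k := by
  induction k with
  | zero =>
    rw [growthKernel_congr (t' := 0) x fun r _ => by simp]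
    simp [stripProd]
  | succ k ih =>
    rw [stripProd_succ, mul_assoc, stripKernel_mul_growthKernel (k + 1) _ x _
      (fun j => if j < k + 1 then t j else 0), ← mul_assoc, ih, mul_assoc]
    · intro j hj
      rw [if_neg (by omega)]
    · intro j
      split_ifs <;> first | rfl | omega
    · intro _
      rw [if_pos (by omega)]

theorem stripProd_mul_growthKernel (t : ℕ → R) (x : R) :
    (stripProd t (ℓ - 1) * growthKernel x t :
      Matrix (BoxPartition ℓ m) (BoxPartition ℓ m) R) =
      growthKernel x 0 * stripProd t (ℓ - 1) := by
  rw [← stripProd_mul_growthKernel_truncate, growthKernel_congr]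
  intro r hr
  rw [if_pos (by omega)]

theorem stripProd_mul_growthProd (t : ℕ → R) (L : List R) :
    (stripProd t (ℓ - 1) * growthProd t L : Matrix (BoxPartition ℓ m) (BoxPartition ℓ m) R) =
      growthProd 0 L * stripProd t (ℓ - 1) := by
  induction L with
  | nil => simp [growthProd]
  | cons x L ih =>
    simp only [growthProd, List.map_cons, List.prod_cons] at ih ⊢
    rw [← mul_assoc, stripProd_mul_growthKernel, mul_assoc, ih, mul_assoc]

theorem stripKernel_empty {k : ℕ} (hk : 0 < k) (s : R) (q : BoxPartition ℓ m) :
    stripKernel k s BoxPartition.empty q =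
      (1 : Matrix (BoxPartition ℓ m) (BoxPartition ℓ m) R) BoxPartition.empty q := by
  rw [stripKernel_apply, Matrix.one_apply]
  by_cases h : BoxPartition.empty = q
  · subst h
    simp
  · rw [if_neg h, if_neg]
    rintro ⟨h1, -, -⟩
    refine h (ext_row fun r _ => ?_)
    have e1 := h1 0 hk
    have e2 := q.row_antitone (Nat.zero_le r)
    rw [row_empty] at e1 ⊢
    omega

theorem stripProd_mul_empty (t : ℕ → R) (k : ℕ)
    (M : Matrix (BoxPartition ℓ m) (BoxPartition ℓ m) R) (q : BoxPartition ℓ m) :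
    (stripProd t k * M : Matrix (BoxPartition ℓ m) (BoxPartition ℓ m) R) BoxPartition.empty q =
      M BoxPartition.empty q := by
  induction k generalizing M with
  | zero => simp [stripProd]
  | succ k ih =>
    rw [stripProd_succ, mul_assoc, ih, Matrix.mul_apply]
    simp_rw [stripKernel_empty k.succ_pos]
    rw [← Matrix.mul_apply, one_mul]

theorem stripProd_mulVec (t : ℕ → R) (k : ℕ) (v : BoxPartition ℓ m → R)
    (hv : ∀ p, v p ≠ 0 → ∀ r < k + 1, p.row r = m) :
    (stripProd t k).mulVec v =
      (growthProd 0 ((List.range k).map fun i => t (i + 1))).mulVec v := by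
  induction k generalizing v with
  | zero => simp [stripProd, growthProd]
  | succ k ih =>
    have hrow : ∀ p q : BoxPartition ℓ m, growthKernel (t (k + 1)) 0 p q * v q ≠ 0 →
        ∀ r < k + 1, p.row r = m ∧ q.row r = m := by
      intro p q h r hr
      have hq := hv q (right_ne_zero_of_mul h)
      have hp := left_ne_zero_of_mul h
      rw [growthKernel_apply_of_vanish _ 0 0 fun _ _ => rfl] at hp
      have h2 := (of_not_not fun hc => hp (if_neg hc)).2 r (Nat.zero_le r)
      rw [hq (r + 1) (by omega)] at h2
      exact ⟨le_antisymm (p.row_le r) h2, hq r (by omega)⟩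
    have hstep : (stripKernel (k + 1) (t (k + 1))).mulVec v =
        (growthKernel (t (k + 1)) 0).mulVec v := by
      funext p
      refine Finset.sum_congr rfl fun q _ => ?_
      change stripKernel (k + 1) (t (k + 1)) p q * v q = growthKernel (t (k + 1)) 0 p q * v q
      by_cases h : growthKernel (t (k + 1)) 0 p q * v q = 0
      · rw [h]
        unfold stripKernel
        split_ifs
        · exact h
        · exact zero_mul _
      · unfold stripKernel
        rw [if_pos fun r hr => ?_]
        obtain ⟨h1, h2⟩ := hrow p q h r hr
        rw [h1, h2]
    rw [stripProd_succ, ← Matrix.mulVec_mulVec, hstep, ih, Matrix.mulVec_mulVec, List.range_succ,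
      List.map_append, growthProd_append]
    · simp [growthProd]
    · intro p hp r hr
      obtain ⟨q, -, hq⟩ := Finset.exists_ne_zero_of_sum_ne_zero hp
      exact (hrow p q hq r hr).1

theorem growthProd_empty_full (hl : 1 ≤ ℓ) (t : ℕ → R) (L : List R) :
    growthProd t L BoxPartition.empty (BoxPartition.full : BoxPartition ℓ m) =
      growthProd 0 (L ++ (List.range (ℓ - 1)).map fun i => t (i + 1))
        BoxPartition.empty (BoxPartition.full : BoxPartition ℓ m) := by
  have hv := stripProd_mulVec t (ℓ - 1) (Pi.single (BoxPartition.full : BoxPartition ℓ m) 1)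
    (fun p hp r hr => by
      have : p = BoxPartition.full := by
        by_contra hc
        exact hp (Pi.single_eq_of_ne hc 1)
      rw [this, row_full (by omega)])
  rw [← stripProd_mul_empty t (ℓ - 1) (growthProd t L), stripProd_mul_growthProd, growthProd_append]
  have h := congrArg (fun w => (growthProd 0 L).mulVec w BoxPartition.empty) hv
  simp only [Matrix.mulVec_single_one] at h
  exact h

/-- The value of a filling at row `r` and column `c`, extended by `0`. -/
def fillValue {N : ℕ} {lam : ℕ → ℕ} (T : YBox ℓ lam → Fin N) (r c : ℕ) : ℕ :=
  if h : r < ℓ ∧ c < lam r then T ⟨⟨r, h.1⟩, ⟨c, h.2⟩⟩ else 0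

theorem fillValue_box {N : ℕ} {lam : ℕ → ℕ} (T : YBox ℓ lam → Fin N) (b : YBox ℓ lam) :
    fillValue T b.1 b.2 = T b := by
  simp [fillValue]

theorem fillValue_of_lt {N : ℕ} {lam : ℕ → ℕ} (T : YBox ℓ lam → Fin N) {r c : ℕ} (hr : r < ℓ)
    (hc : c < lam r) : fillValue T r c = T ⟨⟨r, hr⟩, ⟨c, hc⟩⟩ := by
  simp [fillValue, hr, hc]

theorem fillValue_eq_zero {N : ℕ} {lam : ℕ → ℕ} (T : YBox ℓ lam → Fin N) {r c : ℕ}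
    (h : ¬ (r < ℓ ∧ c < lam r)) : fillValue T r c = 0 := by
  simp only [fillValue, dif_neg h]

theorem isSkewRPP_iff_fillValue (n : ℕ) (lam : ℕ → ℕ) (T : YBox ℓ lam → Fin (n + 1)) :
    IsSkewRPP ℓ n lam (fun _ => 0) T ↔
      (∀ r c, r < ℓ → c < lam r → 1 ≤ fillValue T r c) ∧
      (∀ r c c', r < ℓ → c' < lam r → c ≤ c' → fillValue T r c ≤ fillValue T r c') ∧
      (∀ r r' c, r' < ℓ → c < lam r → c < lam r' → r ≤ r' →
        fillValue T r c ≤ fillValue T r' c) := by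
  constructor
  · rintro ⟨h1, h2, h3⟩
    refine ⟨fun r c hr hc => ?_, fun r c c' hr hc' h => ?_, fun r r' c hr' hc hc' h => ?_⟩
    · rw [fillValue_of_lt T hr hc]
      have := h1 ⟨⟨r, hr⟩, ⟨c, hc⟩⟩
      simp only [Nat.not_lt_zero, iff_false] at this
      omega
    · rw [fillValue_of_lt T hr hc', fillValue_of_lt T hr (h.trans_lt hc')]
      exact h2 _ _ _ (Nat.zero_le _) h
    · rw [fillValue_of_lt T hr' hc', fillValue_of_lt T (h.trans_lt hr') hc]
      exact h3 _ _ _ _ h rfl (Nat.zero_le _) (Nat.zero_le _)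
  · rintro ⟨h1, h2, h3⟩
    refine ⟨fun b => ?_, fun r c c' _ h => ?_, fun r r' c c' h hc _ _ => ?_⟩
    · have := h1 b.1 b.2 b.1.2 b.2.2
      rw [fillValue_box] at this
      simp only [Nat.not_lt_zero, iff_false]
      omega
    · have := h2 r c c' r.2 c'.2 h
      rwa [fillValue_of_lt T r.2 c.2, fillValue_of_lt T r.2 c'.2] at this
    · have := h3 r r' c r'.2 c.2 (hc ▸ c'.2) h
      rw [fillValue_of_lt T r.2 c.2, fillValue_of_lt T r'.2 (hc ▸ c'.2)] at this
      have e : c' = ⟨c, hc ▸ c'.2⟩ := Fin.ext hc.symm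
      rw [e]
      exact this

theorem prod_box {lam : ℕ → ℕ} (f : ℕ → ℕ → R) :
    ∏ b : YBox ℓ lam, f b.1 b.2 =
      ∏ r ∈ Finset.range ℓ, ∏ c ∈ Finset.range (lam r), f r c := by
  rw [Fintype.prod_sigma, Finset.prod_range]
  exact Finset.prod_congr rfl fun r _ => (Finset.prod_range fun c => f r c).symm

theorem prod_boxWeight {n : ℕ} {lam : ℕ → ℕ} {T : YBox ℓ lam → Fin (n + 1)} (x t : ℕ → R)
    (hT : IsSkewRPP ℓ n lam (fun _ => 0) T) :
    ∏ b, boxWeight ℓ n lam (fun _ => 0) x t T b =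
      ∏ r ∈ Finset.range ℓ, ∏ c ∈ Finset.range (lam r),
        if fillValue T (r + 1) c = fillValue T r c then t (r + 1) else x (fillValue T r c) := by
  rw [← prod_box fun r c =>
    if fillValue T (r + 1) c = fillValue T r c then t (r + 1) else x (fillValue T r c)]
  refine Finset.prod_congr rfl fun b _ => ?_
  have hpos := ((isSkewRPP_iff_fillValue n lam T).mp hT).1 b.1 b.2 b.1.2 b.2.2
  unfold boxWeight
  rw [if_pos (Nat.zero_le _), fillValue_box]
  refine if_congr ?_ rfl rfl
  constructor
  · rintro ⟨hr, hc, h⟩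
    rw [fillValue_of_lt T hr hc, h]
  · intro h
    by_cases hb : (b.1 : ℕ) + 1 < ℓ ∧ (b.2 : ℕ) < lam (b.1 + 1)
    · refine ⟨hb.1, hb.2, ?_⟩
      rw [fillValue_of_lt T hb.1 hb.2] at h
      exact Fin.ext h
    · rw [fillValue_eq_zero T hb] at h
      rw [fillValue_box] at hpos
      omega

/-- The shape formed by the entries at most `n` of a filling. -/
def subshape {n : ℕ} {lam : ℕ → ℕ} (T : YBox ℓ lam → Fin (n + 2)) : BoxPartition ℓ m :=
  ofRows fun r => ((Finset.range (lam r)).filter fun c => fillValue T r c ≤ n).card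

theorem mem_iff_lt_card {S : Finset ℕ} (hS : ∀ c c', c ≤ c' → c' ∈ S → c ∈ S) (c : ℕ) :
    c ∈ S ↔ c < S.card := by
  constructor
  · intro h
    have : Finset.range (c + 1) ⊆ S := fun d hd =>
      hS d c (by simpa [Nat.lt_succ_iff] using hd) h
    simpa using Finset.card_le_card this
  · intro h
    by_contra hc
    have : S ⊆ Finset.range c := fun d hd => by
      rw [Finset.mem_range]
      by_contra hcd
      exact hc (hS c d (not_lt.mp hcd) hd)
    have := Finset.card_le_card this
    rw [Finset.card_range] at this
    omega

theorem row_subshape {n : ℕ} {lam : ℕ → ℕ} {q : BoxPartition ℓ m}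
    (hlam : ∀ r < ℓ, lam r = q.row r) {T : YBox ℓ lam → Fin (n + 2)}
    (hT : IsSkewRPP ℓ (n + 1) lam (fun _ => 0) T) {r : ℕ} (hr : r < ℓ) :
    (subshape T : BoxPartition ℓ m).row r =
      ((Finset.range (lam r)).filter fun c => fillValue T r c ≤ n).card := by
  obtain ⟨-, -, h3⟩ := (isSkewRPP_iff_fillValue _ _ _).mp hT
  refine row_ofRows (fun r hr => ?_) (fun r s hrs hs => ?_) hr
  · refine (Finset.card_filter_le _ _).trans ?_
    rw [Finset.card_range, hlam r hr]
    exact q.row_le r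
  · refine Finset.card_le_card fun c hc => ?_
    simp only [Finset.mem_filter, Finset.mem_range] at hc ⊢
    have hc' : c < lam r := by
      rw [hlam r (hrs.trans_lt hs)]
      rw [hlam s hs] at hc
      exact hc.1.trans_le (q.row_antitone hrs)
    exact ⟨hc', (h3 r s c hs hc' hc.1 hrs).trans hc.2⟩

theorem lt_row_subshape {n : ℕ} {lam : ℕ → ℕ} {q : BoxPartition ℓ m}
    (hlam : ∀ r < ℓ, lam r = q.row r) {T : YBox ℓ lam → Fin (n + 2)}
    (hT : IsSkewRPP ℓ (n + 1) lam (fun _ => 0) T) {r : ℕ} (hr : r < ℓ) (c : ℕ) :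
    c < (subshape T : BoxPartition ℓ m).row r ↔ c < lam r ∧ fillValue T r c ≤ n := by
  obtain ⟨-, h2, -⟩ := (isSkewRPP_iff_fillValue _ _ _).mp hT
  rw [row_subshape hlam hT hr, ← mem_iff_lt_card, Finset.mem_filter, Finset.mem_range]
  intro c c' h hc'
  simp only [Finset.mem_filter, Finset.mem_range] at hc' ⊢
  exact ⟨h.trans_lt hc'.1, (h2 r c c' hr hc'.1 h).trans hc'.2⟩

theorem fillValue_le {n : ℕ} {lam : ℕ → ℕ} (T : YBox ℓ lam → Fin (n + 1)) (r c : ℕ) :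
    fillValue T r c ≤ n := by
  unfold fillValue
  split_ifs
  · exact Nat.lt_succ_iff.mp (Fin.is_lt _)
  · exact Nat.zero_le _

theorem fill_ext {N : ℕ} {lam : ℕ → ℕ} {T T' : YBox ℓ lam → Fin N}
    (h : ∀ r c, r < ℓ → c < lam r → fillValue T r c = fillValue T' r c) : T = T' := by
  funext b
  have := h b.1 b.2 b.1.2 b.2.2
  rw [fillValue_box, fillValue_box] at this
  exact Fin.ext this

/-- The restriction of a filling to the boxes of a smaller shape, with entries capped at `n`. -/
def restrictFill {n : ℕ} {lam : ℕ → ℕ} (mu : ℕ → ℕ) (T : YBox ℓ lam → Fin (n + 2)) :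
    YBox ℓ mu → Fin (n + 1) :=
  fun b => ⟨min (fillValue T b.1 b.2) n, by omega⟩

/-- The extension of a filling to a larger shape by the entry `n + 1`. -/
def extendFill {n : ℕ} {mu : ℕ → ℕ} (lam : ℕ → ℕ) (T : YBox ℓ mu → Fin (n + 1)) :
    YBox ℓ lam → Fin (n + 2) :=
  fun b => ⟨if (b.2 : ℕ) < mu b.1 then min (fillValue T b.1 b.2) n else n + 1, by
    split_ifs <;> omega⟩

theorem fillValue_restrictFill {n : ℕ} {lam mu : ℕ → ℕ} (T : YBox ℓ lam → Fin (n + 2)) (r c : ℕ) :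
    fillValue (restrictFill mu T) r c =
      if r < ℓ ∧ c < mu r then min (fillValue T r c) n else 0 := by
  by_cases h : r < ℓ ∧ c < mu r
  · rw [if_pos h, fillValue_of_lt _ h.1 h.2]
    rfl
  · rw [if_neg h, fillValue_eq_zero _ h]

theorem fillValue_extendFill {n : ℕ} {lam mu : ℕ → ℕ} (T : YBox ℓ mu → Fin (n + 1)) (r c : ℕ) :
    fillValue (extendFill lam T) r c =
      if r < ℓ ∧ c < lam r then if c < mu r then fillValue T r c else n + 1 else 0 := by
  by_cases h : r < ℓ ∧ c < lam r
  · rw [if_pos h, fillValue_of_lt _ h.1 h.2, ← min_eq_left (fillValue_le T r c)]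
    rfl
  · rw [if_neg h, fillValue_eq_zero _ h]

theorem prod_Ico_ite_lt (a b d : ℕ) (hb : b ≤ d) (u v : R) :
    (∏ c ∈ Finset.Ico a d, if c < b then u else v) = u ^ (b - a) * v ^ (d - max a b) := by
  rw [Finset.prod_ite, Finset.prod_const, Finset.prod_const]
  simp only [not_lt, Finset.Ico_filter_lt, Finset.Ico_filter_le, Nat.card_Ico, min_eq_right hb]

theorem isSkewRPP_restrictFill_subshape {n : ℕ} {lam : ℕ → ℕ} {p q : BoxPartition ℓ m}
    (hlam : ∀ r < ℓ, lam r = q.row r) {T : YBox ℓ lam → Fin (n + 2)}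
    (hT : IsSkewRPP ℓ (n + 1) lam (fun _ => 0) T) (hp : subshape T = p) :
    IsSkewRPP ℓ n p.row (fun _ => 0) (restrictFill p.row T) := by
  have hlt := fun r (hr : r < ℓ) c => hp ▸ lt_row_subshape hlam hT hr c
  obtain ⟨h1, h2, h3⟩ := (isSkewRPP_iff_fillValue _ _ _).mp hT
  have hval : ∀ r c, r < ℓ → c < p.row r →
      fillValue (restrictFill p.row T) r c = fillValue T r c := by
    intro r c hr hc
    rw [fillValue_restrictFill, if_pos ⟨hr, hc⟩, min_eq_left ((hlt r hr c).mp hc).2]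
  refine (isSkewRPP_iff_fillValue _ _ _).mpr
    ⟨fun r c hr hc => ?_, fun r c c' hr hc' h => ?_, fun r r' c hr' hc hc' h => ?_⟩
  · rw [hval r c hr hc]
    exact h1 r c hr ((hlt r hr c).mp hc).1
  · rw [hval r c hr (h.trans_lt hc'), hval r c' hr hc']
    exact h2 r c c' hr ((hlt r hr c').mp hc').1 h
  · rw [hval r c (h.trans_lt hr') hc, hval r' c hr' hc']
    exact h3 r r' c hr' ((hlt r (h.trans_lt hr') c).mp hc).1 ((hlt r' hr' c).mp hc').1 h

theorem isSkewRPP_extendFill {n : ℕ} {lam : ℕ → ℕ} {p q : BoxPartition ℓ m}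
    (hlam : ∀ r < ℓ, lam r = q.row r) (hpq : ∀ r, p.row r ≤ q.row r)
    {T : YBox ℓ p.row → Fin (n + 1)} (hT : IsSkewRPP ℓ n p.row (fun _ => 0) T) :
    IsSkewRPP ℓ (n + 1) lam (fun _ => 0) (extendFill lam T) ∧
      subshape (extendFill lam T) = p := by
  obtain ⟨h1, h2, h3⟩ := (isSkewRPP_iff_fillValue _ _ _).mp hT
  have hval : ∀ r c, r < ℓ → c < lam r → fillValue (extendFill lam T) r c =
      if c < p.row r then fillValue T r c else n + 1 := by
    intro r c hr hc
    rw [fillValue_extendFill, if_pos ⟨hr, hc⟩]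
  have hle := fillValue_le T
  have hrpp : IsSkewRPP ℓ (n + 1) lam (fun _ => 0) (extendFill lam T) := by
    refine (isSkewRPP_iff_fillValue _ _ _).mpr
      ⟨fun r c hr hc => ?_, fun r c c' hr hc' h => ?_, fun r r' c hr' hc hc' h => ?_⟩
    · rw [hval r c hr hc]
      split_ifs with h
      · exact h1 r c hr h
      · omega
    · rw [hval r c hr (h.trans_lt hc'), hval r c' hr hc']
      split_ifs with e1 e2 e2
      · exact h2 r c c' hr e2 h
      · exact (hle _ _).trans n.le_succ
      · omega
      · exact le_rfl
    · rw [hval r c (h.trans_lt hr') hc, hval r' c hr' hc']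
      have := p.row_antitone h
      split_ifs with e1 e2 e2
      · exact h3 r r' c hr' e1 e2 h
      · exact (hle _ _).trans n.le_succ
      · omega
      · exact le_rfl
  refine ⟨hrpp, ext_row fun r hr => ?_⟩
  refine eq_of_forall_lt_iff fun c => ?_
  rw [lt_row_subshape hlam hrpp hr]
  constructor
  · rintro ⟨hc, h⟩
    rw [hval r c hr hc] at h
    by_contra hcp
    rw [if_neg hcp] at h
    omega
  · intro hc
    have hc' : c < lam r := by
      rw [hlam r hr]
      exact hc.trans_le (hpq r)
    refine ⟨hc', ?_⟩
    rw [hval r c hr hc', if_pos hc]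
    exact hle r c

theorem prod_fillValue_eq_mul_growthKernel {n : ℕ} {lam : ℕ → ℕ} {p q : BoxPartition ℓ m}
    (hlam : ∀ r < ℓ, lam r = q.row r) (hpq : ∀ r, p.row r ≤ q.row r)
    {T : YBox ℓ p.row → Fin (n + 1)} (hT : IsSkewRPP ℓ n p.row (fun _ => 0) T) (x t : ℕ → R) :
    ∏ b, boxWeight ℓ (n + 1) lam (fun _ => 0) x t (extendFill lam T) b =
      (∏ b, boxWeight ℓ n p.row (fun _ => 0) x t T b) * growthKernel (x (n + 1)) t p q := by
  obtain ⟨h1, -, -⟩ := (isSkewRPP_iff_fillValue _ _ _).mp hT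
  have hle := fillValue_le T
  rw [prod_boxWeight x t (isSkewRPP_extendFill hlam hpq hT).1, prod_boxWeight x t hT,
    growthKernel, if_pos hpq, ← Finset.prod_mul_distrib]
  refine Finset.prod_congr rfl fun r hr => ?_
  have hr := Finset.mem_range.mp hr
  rw [hlam r hr, ← Finset.prod_range_mul_prod_Ico _ (hpq r),
    ← prod_Ico_ite_lt _ _ _ (q.row_succ_le r)]
  congr 1
  · refine Finset.prod_congr rfl fun c hc => ?_
    have hc := Finset.mem_range.mp hc
    have e1 : fillValue (extendFill lam T) r c = fillValue T r c := by
      rw [fillValue_extendFill, if_pos ⟨hr, (hlam r hr).symm ▸ hc.trans_le (hpq r)⟩, if_pos hc]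
    rw [e1]
    refine if_congr ?_ rfl rfl
    have e2 := h1 r c hr hc
    have e3 := hle r c
    rw [fillValue_extendFill]
    by_cases hs : r + 1 < ℓ ∧ c < p.row (r + 1)
    · rw [if_pos ⟨hs.1, (hlam _ hs.1).symm ▸ hs.2.trans_le (hpq _)⟩, if_pos hs.2]
    · rw [fillValue_eq_zero T hs]
      split_ifs with e4 e5
      · exact absurd ⟨e4.1, e5⟩ hs
      · omega
      · exact Iff.rfl
  · refine Finset.prod_congr rfl fun c hc => ?_
    have hc := Finset.mem_Ico.mp hc
    have e1 : fillValue (extendFill lam T) r c = n + 1 := by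
      rw [fillValue_extendFill, if_pos ⟨hr, by rw [hlam r hr]; exact hc.2⟩, if_neg (by omega)]
    rw [e1]
    refine if_congr ?_ rfl rfl
    rw [fillValue_extendFill]
    have := p.row_succ_le r
    by_cases hs : r + 1 < ℓ
    · rw [hlam _ hs, if_neg (show ¬ c < p.row (r + 1) by omega)]
      by_cases hcq : c < q.row (r + 1) <;> simp [hs, hcq]
    · rw [if_neg (fun h => hs h.1), q.row_eq_zero (not_lt.mp hs)]
      omega

theorem dualGroth_succ (n : ℕ) (lam : ℕ → ℕ) (q : BoxPartition ℓ m)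
    (hlam : ∀ r < ℓ, lam r = q.row r) (x t : ℕ → R) :
    dualGroth ℓ (n + 1) lam (fun _ => 0) x t =
      ∑ p : BoxPartition ℓ m,
        dualGroth ℓ n p.row (fun _ => 0) x t * growthKernel (x (n + 1)) t p q := by
  unfold dualGroth
  rw [← Finset.sum_fiberwise _ (fun T => (subshape T : BoxPartition ℓ m))]
  refine Finset.sum_congr rfl fun p _ => ?_
  by_cases hpq : ∀ r, p.row r ≤ q.row r
  swap
  · rw [growthKernel, if_neg hpq, mul_zero]
    refine Finset.sum_eq_zero fun T hT => absurd (fun r => ?_) hpq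
    simp only [Finset.mem_filter, Finset.mem_univ, true_and] at hT
    by_cases hr : r < ℓ
    · refine le_of_forall_lt fun c hc => ?_
      rw [← hT.2, lt_row_subshape hlam hT.1 hr] at hc
      rw [← hlam r hr]
      exact hc.1
    · rw [p.row_eq_zero (not_lt.mp hr)]
      exact Nat.zero_le _
  rw [Finset.sum_mul]
  symm
  refine Finset.sum_nbij' (extendFill lam) (restrictFill p.row) ?_ ?_ ?_ ?_ ?_
  · intro T hT
    simp only [Finset.mem_filter, Finset.mem_univ, true_and] at hT ⊢
    exact isSkewRPP_extendFill hlam hpq hT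
  · intro T hT
    simp only [Finset.mem_filter, Finset.mem_univ, true_and] at hT ⊢
    exact isSkewRPP_restrictFill_subshape hlam hT.1 hT.2
  · intro T hT
    refine fill_ext fun r c hr hc => ?_
    rw [fillValue_restrictFill, if_pos ⟨hr, hc⟩, fillValue_extendFill,
      if_pos ⟨hr, (hlam r hr).symm ▸ hc.trans_le (hpq r)⟩, if_pos hc,
      min_eq_left (fillValue_le T r c)]
  · intro T hT
    simp only [Finset.mem_filter, Finset.mem_univ, true_and] at hT
    refine fill_ext fun r c hr hc => ?_
    rw [fillValue_extendFill, if_pos ⟨hr, hc⟩, fillValue_restrictFill]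
    have hlt := lt_row_subshape hlam hT.1 hr c
    rw [hT.2] at hlt
    have := fillValue_le T r c
    split_ifs with h1 h2
    · exact min_eq_left (hlt.mp h1).2
    · exact absurd ⟨hr, h1⟩ h2
    · have : ¬ fillValue T r c ≤ n := fun h => h1 (hlt.mpr ⟨hc, h⟩)
      omega
  · intro T hT
    simp only [Finset.mem_filter, Finset.mem_univ, true_and] at hT
    exact (prod_fillValue_eq_mul_growthKernel hlam hpq hT x t).symm

theorem dualGroth_zero (lam : ℕ → ℕ) (q : BoxPartition ℓ m)
    (hlam : ∀ r < ℓ, lam r = q.row r) (x t : ℕ → R) :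
    dualGroth ℓ 0 lam (fun _ => 0) x t =
      (1 : Matrix (BoxPartition ℓ m) (BoxPartition ℓ m) R) BoxPartition.empty q := by
  unfold dualGroth
  rw [Matrix.one_apply]
  split_ifs with h
  · have : IsEmpty (YBox ℓ lam) := by
      refine ⟨fun b => ?_⟩
      have hzero : lam b.1 = 0 := by rw [hlam _ b.1.2, ← h, row_empty]
      have := b.2.2
      omega
    have hall : ∀ T : YBox ℓ lam → Fin (0 + 1), IsSkewRPP ℓ 0 lam (fun _ => 0) T := fun T =>
      ⟨fun b => isEmptyElim b, fun r c => isEmptyElim (⟨r, c⟩ : YBox ℓ lam),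
        fun r _ c => isEmptyElim (⟨r, c⟩ : YBox ℓ lam)⟩
    rw [Finset.filter_true_of_mem fun T _ => hall T]
    simp
  · refine Finset.sum_eq_zero fun T hT => ?_
    obtain ⟨h1, -, -⟩ := (isSkewRPP_iff_fillValue _ _ _).mp (Finset.mem_filter.mp hT).2
    refine absurd (ext_row fun r hr => ?_) h
    rw [row_empty]
    by_contra hc
    have := h1 r 0 hr (by rw [hlam r hr]; omega)
    have := fillValue_le T r 0
    omega

theorem dualGroth_eq_growthProd (n : ℕ) (lam : ℕ → ℕ) (q : BoxPartition ℓ m)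
    (hlam : ∀ r < ℓ, lam r = q.row r) (x t : ℕ → R) :
    dualGroth ℓ n lam (fun _ => 0) x t =
      growthProd t ((List.range n).map fun i => x (i + 1)) BoxPartition.empty q := by
  induction n generalizing lam q with
  | zero => exact dualGroth_zero lam q hlam x t
  | succ n ih =>
    rw [dualGroth_succ n lam q hlam, List.range_succ, List.map_append, growthProd_append,
      Matrix.mul_apply]
    refine Finset.sum_congr rfl fun p _ => ?_
    rw [ih p.row p fun _ _ => rfl]
    simp [growthProd]

theorem schurPoly_rectangle_eq_dualGroth (ℓ N m : ℕ) (z : ℕ → R) :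
    schurPoly ℓ N (fun _ => m) z = dualGroth ℓ N (fun _ => m) (fun _ => 0) z 0 := by
  unfold schurPoly dualGroth
  trans ∑ T ∈ Finset.univ.filter (IsSSYT ℓ N fun _ => m),
    ∏ b, boxWeight ℓ N (fun _ => m) (fun _ => 0) z 0 T b
  · refine Finset.sum_congr rfl fun T hT => Finset.prod_congr rfl fun b _ => ?_
    obtain ⟨-, -, h3⟩ := (Finset.mem_filter.mp hT).2
    unfold boxWeight
    rw [if_pos (Nat.zero_le _), if_neg]
    rintro ⟨hr, hc, h⟩
    exact (h3 b.1 ⟨b.1 + 1, hr⟩ b.2 ⟨b.2, hc⟩ (Nat.lt_succ_self _) rfl).ne h.symm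
  refine Finset.sum_subset (fun T hT => ?_) fun T hT hT' => ?_
  · obtain ⟨h1, h2, h3⟩ := (Finset.mem_filter.mp hT).2
    refine Finset.mem_filter.mpr ⟨Finset.mem_univ _, fun b => ?_, fun r c c' _ h => h2 r c c' h,
      fun r r' c c' h hc _ _ => ?_⟩
    · have := h1 b
      simp only [Nat.not_lt_zero, iff_false]
      omega
    · rcases h.lt_or_eq with h | h
      · exact (h3 r r' c c' h hc).le
      · obtain rfl := Fin.ext h
        obtain rfl := Fin.ext hc
        exact le_rfl
  · obtain ⟨h1, h2, h3⟩ := (Finset.mem_filter.mp hT).2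
    have hns : ¬ IsSSYT ℓ N (fun _ => m) T := fun h =>
      hT' (Finset.mem_filter.mpr ⟨Finset.mem_univ _, h⟩)
    obtain ⟨r, r', c, hr, h⟩ : ∃ (r r' : Fin ℓ) (c : Fin m), r < r' ∧
        T ⟨r', c⟩ ≤ T ⟨r, c⟩ := by
      by_contra hc
      push Not at hc
      refine hns ⟨fun b => ?_, fun r c c' h => h2 r c c' (Nat.zero_le _) h,
        fun r r' c c' h hcc => ?_⟩
      · have := h1 b
        simp only [Nat.not_lt_zero, iff_false] at this
        omega
      · obtain rfl := Fin.ext hcc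
        exact hc r r' c h
    have hr1 : (r : ℕ) + 1 < ℓ := by omega
    refine Finset.prod_eq_zero (Finset.mem_univ (⟨r, c⟩ : YBox ℓ fun _ => m)) ?_
    unfold boxWeight
    have heq : T ⟨⟨r + 1, hr1⟩, ⟨c, c.2⟩⟩ = T ⟨r, c⟩ := by
      refine le_antisymm (le_trans ?_ h) ?_
      · exact h3 _ _ _ _ (Nat.succ_le_of_lt hr) rfl (Nat.zero_le _) (Nat.zero_le _)
      · exact h3 _ _ _ _ (Nat.le_succ _) rfl (Nat.zero_le _) (Nat.zero_le _)
    rw [if_pos (Nat.zero_le _), if_pos ⟨hr1, c.2, heq⟩]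
    rfl

theorem map_range_add_add {α : Type*} {a b c : ℕ} (z f g h : ℕ → α) (hf : ∀ i < a, z i = f i)
    (hg : ∀ i < b, z (a + i) = g i) (hh : ∀ i < c, z (a + b + i) = h i) :
    (List.range (a + b + c)).map z =
      (List.range a).map f ++ (List.range b).map g ++ (List.range c).map h := by
  simp only [List.range_add, List.map_append, List.map_map]
  congr 1
  · congr 1
    · exact List.map_congr_left fun i hi => hf i (List.mem_range.mp hi)
    · exact List.map_congr_left fun i hi => hg i (List.mem_range.mp hi)
  · exact List.map_congr_left fun i hi => hh i (List.mem_range.mp hi)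

/-- **Cauchy identity for refined dual Grothendieck polynomials.**
`s_{m^ℓ}(x_1,…,x_n,t_1,…,t_{ℓ-1},y_1,…,y_n)
   = Σ_{λ ⊆ m^ℓ} g_λ(x;t) g_{λ†}(y;t†)`,
where `λ†_i = m - λ_{ℓ+1-i}` and `t† = (t_{ℓ-1},…,t_1)`.  Partitions `λ`
contained in the `ℓ × m` rectangle are encoded as antitone functions
`p : Fin ℓ → Fin (m+1)`. -/
theorem refined_dual_grothendieck_cauchy
    {R : Type*} [CommRing R] (m ℓ n : ℕ) (hm : 1 ≤ m) (hl : 1 ≤ ℓ) (hn : 1 ≤ n)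
    (x y t : ℕ → R) :
    schurPoly ℓ (2 * n + ℓ - 1) (fun _ => m)
      (fun k => if k ≤ n then x k
        else if k ≤ n + (ℓ - 1) then t (k - n)
        else y (k - n - (ℓ - 1))) =
      ∑ p ∈ Finset.univ.filter
          (fun p : Fin ℓ → Fin (m + 1) => ∀ i j : Fin ℓ, i ≤ j → p j ≤ p i),
        dualGroth ℓ n (extendFin ℓ fun a => (p a : ℕ)) (fun _ => 0) x t *
          dualGroth ℓ n (fun r => m - extendFin ℓ (fun a => (p a : ℕ)) (ℓ - 1 - r))
            (fun _ => 0) y (fun k => t (ℓ - k)) := by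
  have hX : ∀ p : BoxPartition ℓ m, dualGroth ℓ n (extendFin ℓ fun a => (p.1 a : ℕ))
      (fun _ => 0) x t * dualGroth ℓ n
        (fun r => m - extendFin ℓ (fun a => (p.1 a : ℕ)) (ℓ - 1 - r))
        (fun _ => 0) y (fun k => t (ℓ - k)) =
      growthProd t ((List.range n).map fun i => x (i + 1)) BoxPartition.empty p *
        growthProd t ((List.range n).map fun i => y (i + 1)).reverse p BoxPartition.full := by
    intro p
    have e1 := dualGroth_eq_growthProd n (extendFin ℓ fun a => (p.1 a : ℕ)) p
      (fun _ _ => rfl) x t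
    have e2 := dualGroth_eq_growthProd n
      (fun r => m - extendFin ℓ (fun a => (p.1 a : ℕ)) (ℓ - 1 - r)) p.compl
      (fun r hr => (row_compl p hr).symm) y (fun k => t (ℓ - k))
    rw [e1, e2, growthProd_compl, BoxPartition.compl_compl, compl_empty]
  rw [← Finset.sum_subtype_eq_sum_filter, Finset.subtype_univ]
  refine Eq.trans ?_ (Finset.sum_congr rfl fun p _ => (hX p).symm)
  rw [← Matrix.mul_apply, ← growthProd_append, growthProd_empty_full hl,
    schurPoly_rectangle_eq_dualGroth,
    dualGroth_eq_growthProd _ _ BoxPartition.full fun r hr => (row_full hr).symm]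
  rw [show 2 * n + ℓ - 1 = n + (ℓ - 1) + n by omega]
  rw [map_range_add_add _ (fun i => x (i + 1)) (fun i => t (i + 1)) (fun i => y (i + 1))
    (fun i hi => ?_) (fun i hi => ?_) (fun i hi => ?_)]
  · refine congrFun₂ (growthProd_zero_perm ?_) _ _
    rw [List.append_assoc, List.append_assoc]
    exact (List.perm_append_comm.trans ((List.reverse_perm _).symm.append_right _)).append_left _
  · exact if_pos hi
  · rw [if_neg (by omega), if_pos (by omega), show n + i + 1 - n = i + 1 by omega]
  · rw [if_neg (by omega), if_neg (by omega),
      show n + (ℓ - 1) + i + 1 - n - (ℓ - 1) = i + 1 by omega]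

end
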